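/- arXiv:2409.03641 — 7 statements merged into one kernel-verified Lean document; each statement's English description precedes it below -/
import Mathlib

section
/- Let M be a loopless matroid on a finite ground set E of rank rk_M(E). For a multiset 𝓕 = {F_{r_1} ⊆ F_{r_2} ⊆ … ⊆ F_{r_k}} of nonempty flats of M forming a chain under inclusion, let r_j = rk_M(F_{r_j}) be listed weakly increasingly, let m_𝓕(r) be the number of elements of 𝓕 of rank r, and set C_𝓕 := (−1)^k · (∏_{j=1}^k (r_j − j + 1)) / (∏_{r=1}^{rk_M(E)} m_𝓕(r)!), which is an integer. Then in the Chow ring A^*(M), the staircase class expands as st(M) = ∑_𝓕 C_𝓕 · ∏_{F ∈ 𝓕} x_F, where the sum ranges over all multisets 𝓕 of nonempty flats of M of size k with 0 ≤ k ≤ rk_M(E) that form a chain under inclusion. (This is the formula of Fife and Rincón.) -/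
open Finset MvPolynomial

variable {α : Type*} [DecidableEq α]

/-- A matroid rank function on the ground set `E`: it satisfies `rk A ≤ |A|`, monotonicity and
submodularity (on subsets of `E`). -/
def IsMatroidRank (E : Finset α) (rk : Finset α → ℕ) : Prop :=
  (∀ A ⊆ E, rk A ≤ A.card) ∧
  (∀ A B : Finset α, A ⊆ B → B ⊆ E → rk A ≤ rk B) ∧
  (∀ A B : Finset α, A ⊆ E → B ⊆ E → rk (A ∪ B) + rk (A ∩ B) ≤ rk A + rk B)

/-- `F` is a flat of the matroid on `E` with rank function `rk`:
`F ⊆ E` and `rk F < rk (F ∪ {j})` for every `j ∈ E ∖ F`. -/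
def IsFlat (E : Finset α) (rk : Finset α → ℕ) (F : Finset α) : Prop :=
  F ⊆ E ∧ ∀ j ∈ E \ F, rk F < rk (insert j F)

instance (E : Finset α) (rk : Finset α → ℕ) (F : Finset α) : Decidable (IsFlat E rk F) :=
  inferInstanceAs (Decidable (F ⊆ E ∧ ∀ j ∈ E \ F, rk F < rk (insert j F)))

/-- `L(M)`: the finset of nonempty flats of the matroid on `E` with rank function `rk`. -/
def flats (E : Finset α) (rk : Finset α → ℕ) : Finset (Finset α) :=
  E.powerset.filter fun F => F.Nonempty ∧ IsFlat E rk F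

/-- The index type of the polynomial ring `ℤ[x_F : F ∈ L(M)]`. -/
abbrev FlatIdx (E : Finset α) (rk : Finset α → ℕ) := {F : Finset α // F ∈ flats E rk}

/-- The ideal `I_M + J_M` of `ℤ[x_F : F ∈ L(M)]`: generated by the products `x_F · x_F'` over
incomparable pairs of nonempty flats and, for each `i ∈ E`, the linear form
`∑_{F ∈ L(M), i ∈ F} x_F`. -/
noncomputable def chowIdeal (E : Finset α) (rk : Finset α → ℕ) :
    Ideal (MvPolynomial (FlatIdx E rk) ℤ) :=
  Ideal.span
    ({p | ∃ F F' : FlatIdx E rk, ¬ F.1 ⊆ F'.1 ∧ ¬ F'.1 ⊆ F.1 ∧ p = X F * X F'} ∪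
     {p | ∃ i ∈ E, p = ∑ F ∈ Finset.univ.filter (fun F : FlatIdx E rk => i ∈ F.1), X F})

/-- The staircase polynomial `∏_{r=1}^{rk E} (1 - ∑_{F ∈ L(M), rk F ≥ r} x_F)`. -/
noncomputable def St (E : Finset α) (rk : Finset α → ℕ) : MvPolynomial (FlatIdx E rk) ℤ :=
  ∏ r ∈ Finset.Icc 1 (rk E),
    (1 - ∑ F ∈ Finset.univ.filter (fun F : FlatIdx E rk => r ≤ rk F.1), X F)

/-- The Fife–Rincón coefficient of a multiset of flats, written with exact integer division:
`(-1)^k · (∏_{j=1}^k (r_j - j + 1)) / (∏_{r=1}^{rk E} m(r)!)` where `r_1 ≤ … ≤ r_k` are the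
ranks of the members of the multiset listed weakly increasingly and `m(r)` is the number of
members of rank `r`. -/
noncomputable def FRcoeff (E : Finset α) (rk : Finset α → ℕ) (m : Multiset (FlatIdx E rk)) : ℤ :=
  ((-1 : ℤ) ^ Multiset.card m *
      ∏ j ∈ Finset.range (Multiset.card m),
        ((((m.map fun F => rk F.1).sort (· ≤ ·)).getD j 0 : ℤ) - (j : ℤ))) /
    ∏ r ∈ Finset.Icc 1 (rk E), (((m.map fun F => rk F.1).count r).factorial : ℤ)

/-- The product `∏ j, (l_j - j)` over the entries of a list. -/
def shiftedProd (l : List ℕ) : ℤ :=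
  ∏ j ∈ Finset.range l.length, ((l.getD j 0 : ℤ) - (j : ℤ))

/-- The falling factorial `x (x - 1) ⋯ (x - t + 1)`. -/
def fallingFact (x : ℤ) (t : ℕ) : ℤ := ∏ i ∈ Finset.range t, (x - i)

theorem fallingFact_add (x : ℤ) (u t : ℕ) :
    fallingFact x (u + t) = fallingFact x u * fallingFact (x - u) t := by
  simp only [fallingFact, Finset.prod_range_add]
  congr 1
  refine Finset.prod_congr rfl fun i _ => ?_
  push_cast
  ring

theorem fallingFact_add_one (x : ℤ) (t : ℕ) :
    fallingFact (x + 1) t = fallingFact x t + t * fallingFact x (t - 1) := by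
  cases t with
  | zero => simp [fallingFact]
  | succ t =>
    have h : fallingFact (x + 1) (t + 1) = fallingFact x t * (x + 1) := by
      simp only [fallingFact, Finset.prod_range_succ']
      congr 1
      · refine Finset.prod_congr rfl fun i _ => ?_
        push_cast
        ring
      · simp
    rw [h, fallingFact_add]
    simp only [fallingFact, Nat.add_sub_cancel, Finset.prod_range_one]
    push_cast
    ring

theorem fallingFact_zero_of_ne_zero {t : ℕ} (ht : t ≠ 0) : fallingFact 0 t = 0 :=
  Finset.prod_eq_zero (Finset.mem_range.2 (Nat.pos_of_ne_zero ht)) (by simp)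

theorem shiftedProd_append_replicate (l : List ℕ) (u c : ℕ) :
    shiftedProd (l ++ List.replicate u c) = shiftedProd l * fallingFact (c - l.length) u := by
  simp only [shiftedProd, fallingFact, List.length_append, List.length_replicate,
    Finset.prod_range_add]
  congr 1
  · refine Finset.prod_congr rfl fun i hi => ?_
    rw [List.getD_append _ _ _ _ (Finset.mem_range.1 hi)]
  · refine Finset.prod_congr rfl fun i hi => ?_
    rw [List.getD_append_right _ _ _ _ (by omega)]
    have := Finset.mem_range.1 hi
    simp only [Nat.add_sub_cancel_left, List.getD_replicate _ this]
    push_cast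
    ring

/-- The value of `shiftedProd` on the sorted list of the numbers `min r n`, `r ∈ s`. -/
noncomputable def truncShiftedProd (n : ℕ) (s : Multiset ℕ) : ℤ :=
  shiftedProd ((s.filter (· ≤ n)).sort (· ≤ ·)) *
    fallingFact (n - Multiset.card (s.filter (· ≤ n))) (Multiset.card (s.filter (n < ·)))

theorem sort_filter_le_succ (n : ℕ) (s : Multiset ℕ) :
    (s.filter (· ≤ n + 1)).sort (· ≤ ·) =
      (s.filter (· ≤ n)).sort (· ≤ ·) ++ List.replicate (s.count (n + 1)) (n + 1) := by
  refine List.Perm.eq_of_pairwise' (r := (· ≤ ·)) (Multiset.pairwise_sort _ _) ?_ ?_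
  · rw [List.pairwise_append]
    refine ⟨Multiset.pairwise_sort _ _, by simp [List.pairwise_replicate], ?_⟩
    intro a ha b hb
    have h1 : a ≤ n := by simpa using (Multiset.mem_filter.1 ((Multiset.mem_sort _).1 ha)).2
    have h2 := List.eq_of_mem_replicate hb
    omega
  · rw [← Multiset.coe_eq_coe, Multiset.sort_eq, ← Multiset.coe_add, Multiset.sort_eq,
      Multiset.coe_replicate]
    ext a
    simp only [Multiset.count_filter, Multiset.count_add, Multiset.count_replicate]
    rcases lt_trichotomy a (n + 1) with h | h | h
    · rw [if_pos (by omega), if_pos (by omega), if_neg (by omega), add_zero]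
    · subst h
      simp
    · rw [if_neg (by omega), if_neg (by omega), if_neg (by omega)]

theorem truncShiftedProd_succ (n : ℕ) (s : Multiset ℕ) :
    truncShiftedProd (n + 1) s =
      shiftedProd ((s.filter (· ≤ n)).sort (· ≤ ·)) *
        fallingFact (n - Multiset.card (s.filter (· ≤ n)) + 1)
          (Multiset.card (s.filter (n < ·))) := by
  have hlen := congrArg List.length (sort_filter_le_succ n s)
  simp only [Multiset.length_sort, List.length_append, List.length_replicate] at hlen
  have hcard : Multiset.card (s.filter (n < ·)) =
      s.count (n + 1) + Multiset.card (s.filter (n + 1 < ·)) := by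
    have h1 := congrArg Multiset.card (Multiset.filter_add_not (· ≤ n) s)
    have h2 := congrArg Multiset.card (Multiset.filter_add_not (· ≤ n + 1) s)
    simp only [not_le, Multiset.card_add] at h1 h2
    omega
  rw [truncShiftedProd, sort_filter_le_succ, shiftedProd_append_replicate, hcard, fallingFact_add,
    hlen, Multiset.length_sort, mul_assoc]
  push_cast
  congr 3 <;> ring

theorem truncShiftedProd_succ_eq (n : ℕ) (s : Multiset ℕ) :
    truncShiftedProd (n + 1) s = truncShiftedProd n s +
      Multiset.card (s.filter (n < ·)) *
        (shiftedProd ((s.filter (· ≤ n)).sort (· ≤ ·)) *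
          fallingFact (n - Multiset.card (s.filter (· ≤ n)))
            (Multiset.card (s.filter (n < ·)) - 1)) := by
  rw [truncShiftedProd_succ, fallingFact_add_one, truncShiftedProd]
  ring

theorem truncShiftedProd_of_cons {n a : ℕ} (ha : n < a) (s : Multiset ℕ) :
    truncShiftedProd n s =
      shiftedProd (((a ::ₘ s).filter (· ≤ n)).sort (· ≤ ·)) *
        fallingFact (n - Multiset.card ((a ::ₘ s).filter (· ≤ n)))
          (Multiset.card ((a ::ₘ s).filter (n < ·)) - 1) := by
  rw [Multiset.filter_cons_of_neg _ (by omega), Multiset.filter_cons_of_pos _ ha,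
    Multiset.card_cons, Nat.add_sub_cancel, truncShiftedProd]

theorem truncShiftedProd_of_forall_le {n : ℕ} {s : Multiset ℕ} (h : ∀ a ∈ s, a ≤ n) :
    truncShiftedProd n s = shiftedProd (s.sort (· ≤ ·)) := by
  have h1 : s.filter (n < ·) = 0 := Multiset.filter_eq_nil.2 fun a ha => by have := h a ha; omega
  rw [truncShiftedProd, Multiset.filter_eq_self.2 h, h1]
  simp [fallingFact]

theorem truncShiftedProd_zero {s : Multiset ℕ} (h : ∀ a ∈ s, a ≠ 0) :
    truncShiftedProd 0 s = if s = 0 then 1 else 0 := by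
  have h1 : s.filter (· ≤ 0) = 0 := Multiset.filter_eq_nil.2 fun a ha => by have := h a ha; omega
  have h2 : s.filter (0 < ·) = s := Multiset.filter_eq_self.2 fun a ha => by have := h a ha; omega
  rw [truncShiftedProd, h1, h2]
  split_ifs with hs
  · simp [hs, shiftedProd, fallingFact]
  · simp [fallingFact_zero_of_ne_zero (mt Multiset.card_eq_zero.1 hs)]

section Staircase

variable {σ : Type*} [Fintype σ]

/-- The product `∏_{r=1}^n (1 - ∑_{ρ F ≥ r} X_F)`. -/
noncomputable def staircaseProd (ρ : σ → ℕ) (n : ℕ) : MvPolynomial σ ℤ :=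
  ∏ r ∈ Finset.Icc 1 n, (1 - ∑ F ∈ Finset.univ.filter (fun F => r ≤ ρ F), X F)

theorem staircaseProd_succ (ρ : σ → ℕ) (n : ℕ) :
    staircaseProd ρ (n + 1) =
      staircaseProd ρ n * (1 - ∑ F ∈ Finset.univ.filter (fun F => n + 1 ≤ ρ F), X F) :=
  Finset.prod_Icc_succ_top (by omega) _

theorem totalDegree_staircaseProd_le (ρ : σ → ℕ) (n : ℕ) :
    (staircaseProd ρ n).totalDegree ≤ n := by
  refine (totalDegree_finsetProd _ _).trans ?_
  refine (Finset.sum_le_card_nsmul _ _ 1 fun r _ => ?_).trans (by simp)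
  refine (totalDegree_sub _ _).trans (max_le (by simp) ?_)
  exact totalDegree_finsetSum_le fun F _ => by simp

variable [DecidableEq σ]

theorem sum_card_filter_map (ρ : σ → ℕ) (n : ℕ) (m : Multiset σ) :
    ∑ F ∈ Finset.univ.filter (fun F => n + 1 ≤ ρ F), m.count F =
      Multiset.card ((m.map ρ).filter (n < ·)) := by
  rw [Multiset.filter_map, Multiset.card_map,
    ← Multiset.sum_count_eq_card (s := Finset.univ) (by simp), Finset.sum_filter]
  refine Finset.sum_congr rfl fun F _ => ?_
  rw [Multiset.count_filter]
  rfl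

theorem prod_factorial_count_cons (m : Multiset σ) (F : σ) :
    ∏ G, ((F ::ₘ m).count G).factorial =
      (F ::ₘ m).count F * ∏ G, (m.count G).factorial := by
  rw [← Finset.mul_prod_erase _ _ (Finset.mem_univ F),
    ← Finset.mul_prod_erase Finset.univ (fun G => (m.count G).factorial) (Finset.mem_univ F),
    Multiset.count_cons_self, Nat.factorial_succ, mul_assoc]
  congr 2
  refine Finset.prod_congr rfl fun G hG => ?_
  rw [Multiset.count_cons_of_ne (Finset.ne_of_mem_erase hG)]

theorem coeff_staircaseProd_mul (ρ : σ → ℕ) (hρ : ∀ F, ρ F ≠ 0) (n : ℕ) (m : Multiset σ) :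
    coeff (Multiset.toFinsupp m) (staircaseProd ρ n) * ((∏ F, (m.count F).factorial : ℕ) : ℤ) =
      (-1) ^ Multiset.card m * truncShiftedProd n (m.map ρ) := by
  induction n generalizing m with
  | zero =>
    rw [truncShiftedProd_zero (by simpa using fun F _ => hρ F)]
    by_cases hm : m = 0
    · simp [hm, staircaseProd]
    · have : (0 : σ →₀ ℕ) ≠ Multiset.toFinsupp m := fun h =>
        hm (by simpa using h.symm)
      simp [hm, staircaseProd, coeff_one, this]
  | succ n ih =>
    rw [staircaseProd_succ, mul_sub, mul_one, Finset.mul_sum, coeff_sub, coeff_sum, sub_mul, ih,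
      truncShiftedProd_succ_eq, mul_add, sub_eq_add_neg, ← sum_card_filter_map, Finset.sum_mul,
      ← Finset.sum_neg_distrib]
    congr 1
    push_cast
    rw [Finset.sum_mul, Finset.mul_sum]
    refine Finset.sum_congr rfl fun F hF => ?_
    have hF' : n < ρ F := (Finset.mem_filter.1 hF).2
    by_cases hm : F ∈ m
    · obtain ⟨m', rfl⟩ := Multiset.exists_cons_of_mem hm
      have hsub : Multiset.toFinsupp (F ::ₘ m') = Multiset.toFinsupp m' + Finsupp.single F 1 := by
        rw [← Multiset.singleton_add, map_add, Multiset.toFinsupp_singleton, add_comm]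
      have hfac := congrArg (Nat.cast (R := ℤ)) (prod_factorial_count_cons m' F)
      have key := ih m'
      push_cast at key hfac
      rw [hfac, hsub, coeff_mul_X, mul_left_comm, key, truncShiftedProd_of_cons hF',
        ← Multiset.map_cons, ← sum_card_filter_map, Multiset.card_cons, pow_succ]
      ring
    · have h0 : F ∉ (Multiset.toFinsupp m).support := by simpa using hm
      rw [coeff_mul_X', if_neg h0, Multiset.count_eq_zero_of_notMem hm]
      simp

theorem staircaseProd_eq_sum (ρ : σ → ℕ) (n : ℕ) :
    staircaseProd ρ n = ∑ k ∈ Finset.range (n + 1), ∑ m : Sym σ k,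
      coeff (Multiset.toFinsupp (m : Multiset σ)) (staircaseProd ρ n) •
        ((m : Multiset σ).map fun F => (X F : MvPolynomial σ ℤ)).prod := by
  have hmon : ∀ m : Multiset σ, (m.map fun F => (X F : MvPolynomial σ ℤ)).prod =
      monomial (Multiset.toFinsupp m) 1 := fun m => by
    induction m using Multiset.induction_on with
    | empty => simp
    | cons F m ih =>
      rw [Multiset.map_cons, Multiset.prod_cons, ih, ← Multiset.singleton_add, map_add,
        Multiset.toFinsupp_singleton, X, monomial_mul, one_mul]
  ext e
  obtain ⟨m, rfl⟩ := Multiset.toFinsupp.surjective e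
  simp only [coeff_sum, hmon, coeff_smul, coeff_monomial, EmbeddingLike.apply_eq_iff_eq,
    smul_eq_mul, mul_ite, mul_one, mul_zero]
  have hsum : ∀ k, (∑ m' : Sym σ k, if (m' : Multiset σ) = m then
      coeff (Multiset.toFinsupp (m' : Multiset σ)) (staircaseProd ρ n) else 0) =
      if Multiset.card m = k then coeff (Multiset.toFinsupp m) (staircaseProd ρ n) else 0 := by
    intro k
    split_ifs with hk
    · rw [Finset.sum_eq_single (Sym.mk m hk)]
      · simp
      · intro m' _ hne
        exact if_neg fun h => hne (Subtype.ext h)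
      · simp
    · refine Finset.sum_eq_zero fun m' _ => if_neg fun h => hk ?_
      rw [← h]
      exact m'.2
  simp only [hsum, Finset.sum_ite_eq, Finset.mem_range]
  split_ifs with h
  · rfl
  · refine coeff_eq_zero_of_totalDegree_lt ((totalDegree_staircaseProd_le ρ n).trans_lt ?_)
    have : ∑ i ∈ (Multiset.toFinsupp m).support, (Multiset.toFinsupp m) i = Multiset.card m := by
      simp
    omega

theorem prod_factorial_count_map (ρ : σ → ℕ) (n : ℕ) (m : Multiset σ)
    (hinj : Set.InjOn ρ {F | F ∈ m}) (hm : ∀ F ∈ m, ρ F ∈ Finset.Icc 1 n) :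
    ∏ r ∈ Finset.Icc 1 n, ((m.map ρ).count r).factorial = ∏ F, (m.count F).factorial := by
  have h1 : ∏ F ∈ m.toFinset, (m.count F).factorial = ∏ F, (m.count F).factorial :=
    Finset.prod_subset (Finset.subset_univ _) fun F _ hF => by
      rw [Multiset.count_eq_zero_of_notMem (by simpa using hF), Nat.factorial_zero]
  have h2 : ∏ r ∈ m.toFinset.image ρ, ((m.map ρ).count r).factorial =
      ∏ r ∈ Finset.Icc 1 n, ((m.map ρ).count r).factorial := by
    refine Finset.prod_subset ?_ fun r _ hr => ?_
    · intro r hr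
      obtain ⟨F, hF, rfl⟩ := Finset.mem_image.1 hr
      exact hm F (Multiset.mem_toFinset.1 hF)
    · rw [Multiset.count_eq_zero_of_notMem (by simpa using hr), Nat.factorial_zero]
  rw [← h1, ← h2, Finset.prod_image fun F hF G hG => hinj (Multiset.mem_toFinset.1 hF) (Multiset.mem_toFinset.1 hG)]
  refine Finset.prod_congr rfl fun F hF => ?_
  rw [Multiset.count_map_eq_count ρ m hinj F (Multiset.mem_toFinset.1 hF)]

end Staircase

theorem rk_ne_zero_of_flat {E : Finset α} {rk : Finset α → ℕ} (hM : IsMatroidRank E rk)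
    (hloopless : ∀ j ∈ E, rk {j} ≠ 0) (F : FlatIdx E rk) : rk F.1 ≠ 0 := by
  obtain ⟨hFE, ⟨j, hj⟩, -⟩ := by simpa [flats] using F.2
  have h1 := hM.2.1 {j} F.1 (by simpa using hj) hFE
  have h2 := hloopless j (hFE hj)
  omega

theorem rk_le_of_flat {E : Finset α} {rk : Finset α → ℕ} (hM : IsMatroidRank E rk)
    (F : FlatIdx E rk) : rk F.1 ≤ rk E := by
  obtain ⟨hFE, -⟩ := by simpa [flats] using F.2
  exact hM.2.1 _ _ hFE subset_rfl

theorem eq_of_flat_subset_of_rk_eq {E : Finset α} {rk : Finset α → ℕ} (hM : IsMatroidRank E rk)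
    {F G : FlatIdx E rk} (h : F.1 ⊆ G.1) (hrk : rk F.1 = rk G.1) : F = G := by
  obtain ⟨-, -, -, hF⟩ := by simpa [flats, IsFlat] using F.2
  obtain ⟨hGE, -⟩ := by simpa [flats] using G.2
  refine Subtype.ext (h.antisymm fun j hj => ?_)
  by_contra hjF
  have h1 := hF j (hGE hj) hjF
  have h2 := hM.2.1 (insert j F.1) G.1 (Finset.insert_subset hj h) hGE
  omega

theorem FRcoeff_eq_coeff {E : Finset α} {rk : Finset α → ℕ} (hM : IsMatroidRank E rk)
    (hloopless : ∀ j ∈ E, rk {j} ≠ 0) (m : Multiset (FlatIdx E rk))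
    (hchain : ∀ F ∈ m, ∀ G ∈ m, F.1 ⊆ G.1 ∨ G.1 ⊆ F.1) :
    FRcoeff E rk m = coeff (Multiset.toFinsupp m) (St E rk) := by
  have hρ := rk_ne_zero_of_flat hM hloopless
  have hle := rk_le_of_flat hM (E := E) (rk := rk)
  have key := coeff_staircaseProd_mul (fun F : FlatIdx E rk => rk F.1) hρ (rk E) m
  rw [truncShiftedProd_of_forall_le (by rintro _ h; obtain ⟨F, -, rfl⟩ := Multiset.mem_map.1 h; exact hle F)] at key
  rw [← prod_factorial_count_map (fun F : FlatIdx E rk => rk F.1) (rk E) m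
    (fun F hF G hG h => (hchain F hF G hG).elim
      (fun hs => eq_of_flat_subset_of_rk_eq hM hs h)
      (fun hs => (eq_of_flat_subset_of_rk_eq hM hs h.symm).symm))
    (fun F _ => Finset.mem_Icc.2 ⟨Nat.one_le_iff_ne_zero.2 (hρ F), hle F⟩)] at key
  rw [shiftedProd, Multiset.length_sort, Multiset.card_map, Nat.cast_prod] at key
  rw [FRcoeff, ← key]
  refine Int.mul_ediv_cancel _ (Finset.prod_ne_zero_iff.2 fun r _ => ?_)
  exact_mod_cast Nat.factorial_ne_zero _

theorem prod_X_mem_chowIdeal {E : Finset α} {rk : Finset α → ℕ} {m : Multiset (FlatIdx E rk)}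
    (h : ¬ ∀ F ∈ m, ∀ G ∈ m, F.1 ⊆ G.1 ∨ G.1 ⊆ F.1) :
    (m.map fun F => (X F : MvPolynomial (FlatIdx E rk) ℤ)).prod ∈ chowIdeal E rk := by
  push Not at h
  obtain ⟨F, hF, G, hG, h1, h2⟩ := h
  obtain ⟨m, rfl⟩ := Multiset.exists_cons_of_mem hF
  have hGF : G ≠ F := by
    rintro rfl
    exact h1 subset_rfl
  obtain ⟨m, rfl⟩ := Multiset.exists_cons_of_mem ((Multiset.mem_cons.1 hG).resolve_left hGF)
  rw [Multiset.map_cons, Multiset.map_cons, Multiset.prod_cons, Multiset.prod_cons, ← mul_assoc]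
  exact Ideal.mul_mem_right _ _ (Ideal.subset_span (Or.inl ⟨F, G, h1, h2, rfl⟩))

/-- The formula of Fife and Rincón: in the Chow ring `A^*(M)` of a loopless matroid, the
staircase class equals `∑_𝓕 C_𝓕 ∏_{F ∈ 𝓕} x_F`, summed over all multisets `𝓕` of nonempty
flats of size `k ≤ rk E` which form a chain under inclusion. -/
theorem staircase_expansion (E : Finset α) (rk : Finset α → ℕ) (hM : IsMatroidRank E rk)
    (hloopless : ∀ j ∈ E, rk {j} ≠ 0) :
    Ideal.Quotient.mk (chowIdeal E rk) (St E rk) =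
      Ideal.Quotient.mk (chowIdeal E rk)
        (∑ k ∈ Finset.range (rk E + 1), ∑ 𝓕 : Sym (FlatIdx E rk) k,
          if ∀ F ∈ (𝓕 : Multiset (FlatIdx E rk)), ∀ G ∈ (𝓕 : Multiset (FlatIdx E rk)),
              F.1 ⊆ G.1 ∨ G.1 ⊆ F.1 then
            FRcoeff E rk (𝓕 : Multiset (FlatIdx E rk)) •
              ((𝓕 : Multiset (FlatIdx E rk)).map
                fun F => (X F : MvPolynomial (FlatIdx E rk) ℤ)).prod
          else 0) := by
  have hSt : St E rk = _ := staircaseProd_eq_sum (fun F : FlatIdx E rk => rk F.1) (rk E)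
  rw [hSt]
  simp only [map_sum]
  refine Finset.sum_congr rfl fun k _ => Finset.sum_congr rfl fun m _ => ?_
  split_ifs with h
  · rw [FRcoeff_eq_coeff hM hloopless _ h]
    rfl
  · rw [map_zsmul, Ideal.Quotient.eq_zero_iff_mem.2 (prod_X_mem_chowIdeal h), smul_zero, map_zero]
end

section
/- For every n ≥ 0, the following identity holds in the polynomial ring ℚ[x_1, …, x_n]: ∏_{r=1}^{n} (1 − ∑_{i=r}^{n} x_i) = ∑_{k=0}^{n} ∑_{(r_1,…,r_k)} (−1)^k · (∏_{j=1}^{k} (r_j − j + 1)) / (∏_{r=1}^{n} m(r)!) · x_{r_1} x_{r_2} ⋯ x_{r_k}, where the inner sum ranges over all weakly increasing sequences 1 ≤ r_1 ≤ r_2 ≤ … ≤ r_k ≤ n and m(r) = #{j : r_j = r} denotes the multiplicity of r in the sequence. -/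
open Finset MvPolynomial

/-- The number of ways, up to the order of the values, to choose distinct `s ≤ v` for each of the
`m v` occurrences of every value `v < n`. -/
def staircaseCoeff (n : ℕ) (m : ℕ → ℕ) : ℕ :=
  ∏ v ∈ range n, (v + 1 - ∑ u ∈ range v, m u).choose (m v)

lemma staircaseCoeff_succ (n : ℕ) (m : ℕ → ℕ) :
    staircaseCoeff (n + 1) m =
      staircaseCoeff n m * (n + 1 - ∑ u ∈ range n, m u).choose (m n) :=
  prod_range_succ _ _

lemma staircaseCoeff_congr {n : ℕ} {m m' : ℕ → ℕ} (h : ∀ v < n, m v = m' v) :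
    staircaseCoeff n m = staircaseCoeff n m' := by
  refine prod_congr rfl fun v hv => ?_
  have hv := mem_range.1 hv
  rw [h v hv, sum_congr rfl fun u hu => h u ((mem_range.1 hu).trans hv)]

lemma staircaseCoeff_eq_zero {n : ℕ} {m : ℕ → ℕ} (h : n < ∑ u ∈ range n, m u) :
    staircaseCoeff n m = 0 := by
  induction n with
  | zero => simp at h
  | succ n ih =>
    rw [staircaseCoeff_succ]
    rw [sum_range_succ] at h
    by_cases h' : n < ∑ u ∈ range n, m u
    · rw [ih h', zero_mul]
    · rw [Nat.choose_eq_zero_of_lt (by omega), mul_zero]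

section Expansion

variable {A : Type*} [CommRing A]

/-- The homogeneous component of degree `k` of the staircase product, up to sign. -/
def staircaseSum (x : ℕ → A) (n k : ℕ) : A :=
  ∑ m ∈ piAntidiag (range n) k, (staircaseCoeff n m : A) * ∏ v ∈ range n, x v ^ m v

lemma staircaseSum_eq_zero (x : ℕ → A) {n k : ℕ} (h : n < k) : staircaseSum x n k = 0 := by
  refine sum_eq_zero fun m hm => ?_
  rw [staircaseCoeff_eq_zero (by rwa [(mem_piAntidiag.1 hm).1]), Nat.cast_zero, zero_mul]

lemma staircaseSum_succ (x : ℕ → A) (n K : ℕ) :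
    staircaseSum x (n + 1) K = ∑ k ∈ range (K + 1),
      ((n + 1 - k).choose (K - k) : A) * x n ^ (K - k) * staircaseSum x n k := by
  have hn : range (n + 1) = cons n (range n) notMem_range_self := by
    rw [range_add_one, cons_eq_insert]
  rw [staircaseSum, hn, piAntidiag_cons, sum_disjiUnion, ← hn,
    ← Nat.sum_antidiagonal_eq_sum_range_succ
      fun k b => ((n + 1 - k).choose b : A) * x n ^ b * staircaseSum x n k,
    ← Nat.sum_antidiagonal_swap]
  refine sum_congr rfl fun p _ => ?_
  rw [sum_map, staircaseSum, mul_sum]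
  refine sum_congr rfl fun m hm => ?_
  obtain ⟨hs, hm⟩ := mem_piAntidiag.1 hm
  have hmn : m n = 0 := by
    by_contra h
    exact notMem_range_self (hm n h)
  have hlt : ∀ v < n, (m + fun t => if t = n then p.2 else 0) v = m v := fun v hv => by
    simp [hv.ne]
  have hlast : (m + fun t => if t = n then p.2 else 0) n = p.2 := by simp [hmn]
  simp only [addRightEmbedding_apply, Prod.fst_swap]
  rw [staircaseCoeff_succ, prod_range_succ, hlast, staircaseCoeff_congr hlt,
    sum_congr rfl fun u hu => hlt u (mem_range.1 hu), hs,
    prod_congr rfl fun u hu => by rw [hlt u (mem_range.1 hu)]]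
  push_cast
  ring

theorem prod_staircase (x : ℕ → A) (n : ℕ) (t : A) :
    ∏ r ∈ range n, (t - ∑ i ∈ Ico r n, x i) =
      ∑ k ∈ range (n + 1), (-1) ^ k * staircaseSum x n k * t ^ (n - k) := by
  induction n generalizing t with
  | zero => simp [staircaseSum, staircaseCoeff]
  | succ n ih =>
    have hprod : ∏ r ∈ range n, (t - ∑ i ∈ Ico r (n + 1), x i) =
        ∏ r ∈ range n, ((t - x n) - ∑ i ∈ Ico r n, x i) :=
      prod_congr rfl fun r hr => by
        rw [sum_Ico_succ_top (mem_range.1 hr).le]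
        ring
    rw [prod_range_succ, hprod, ih]
    trans ∑ k ∈ range (n + 2), ∑ b ∈ range (n + 2 - k), (-1) ^ (k + b) *
      (((n + 1 - k).choose b : A) * x n ^ b * staircaseSum x n k) * t ^ (n + 1 - (k + b))
    · rw [sum_range_succ _ (n + 1), staircaseSum_eq_zero x n.lt_succ_self]
      simp only [mul_zero, zero_mul, sum_const_zero, add_zero, Nat.Ico_succ_singleton,
        sum_singleton]
      rw [sum_mul]
      refine sum_congr rfl fun k hk => ?_
      have hk := mem_range.1 hk
      rw [mul_assoc, ← pow_succ, show n - k + 1 = n + 1 - k by omega, sub_eq_neg_add, add_pow,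
        mul_sum, show n + 1 - k + 1 = n + 2 - k by omega]
      refine sum_congr rfl fun b _ => ?_
      rw [neg_pow, pow_add, Nat.sub_sub]
      ring
    · rw [← sum_range_diag_flip (n + 2) fun k b => (-1) ^ (k + b) *
        (((n + 1 - k).choose b : A) * x n ^ b * staircaseSum x n k) * t ^ (n + 1 - (k + b))]
      refine sum_congr rfl fun K _ => ?_
      rw [staircaseSum_succ, mul_sum, sum_mul]
      refine sum_congr rfl fun k hk => ?_
      rw [Nat.add_sub_cancel' (mem_range_succ_iff.1 hk)]

end Expansion

/-- The weakly increasing list in which each `v < n` occurs `m v` times. -/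
def sortedList (m : ℕ → ℕ) : ℕ → List ℕ
  | 0 => []
  | n + 1 => sortedList m n ++ List.replicate (m n) n

lemma length_sortedList (m : ℕ → ℕ) (n : ℕ) :
    (sortedList m n).length = ∑ v ∈ range n, m v := by
  induction n with
  | zero => rfl
  | succ n ih => simp [sortedList, ih, sum_range_succ]

lemma lt_of_mem_sortedList {m : ℕ → ℕ} {n a : ℕ} (h : a ∈ sortedList m n) : a < n := by
  induction n with
  | zero => simp [sortedList] at h
  | succ n ih =>
    rcases List.mem_append.1 h with h | h
    · exact (ih h).trans n.lt_succ_self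
    · exact (List.eq_of_mem_replicate h).trans_lt n.lt_succ_self

lemma count_sortedList (m : ℕ → ℕ) (n a : ℕ) :
    (sortedList m n).count a = if a < n then m a else 0 := by
  induction n with
  | zero => simp [sortedList]
  | succ n ih =>
    rw [sortedList, List.count_append, ih, List.count_replicate]
    rcases lt_trichotomy a n with h | rfl | h
    · simp [h, h.ne', h.trans n.lt_succ_self]
    · simp
    · simp [h.ne, h.not_gt, (Nat.succ_le_of_lt h).not_gt]

lemma pairwise_sortedList (m : ℕ → ℕ) (n : ℕ) : (sortedList m n).Pairwise (· ≤ ·) := by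
  induction n with
  | zero => exact List.Pairwise.nil
  | succ n ih =>
    refine List.pairwise_append.2 ⟨ih, List.pairwise_replicate.2 (Or.inr le_rfl), ?_⟩
    intro a ha b hb
    rw [List.eq_of_mem_replicate hb]
    exact (lt_of_mem_sortedList ha).le

lemma prod_mapIdx_replicate {M : Type*} [CommMonoid M] (φ : ℕ → ℕ → M) (b v : ℕ) :
    ((List.replicate b v).mapIdx φ).prod = ∏ i ∈ range b, φ i v := by
  induction b with
  | zero => simp
  | succ b ih => simp [List.replicate_succ', List.mapIdx_append, ih, prod_range_succ]

lemma prod_mapIdx_sortedList {M : Type*} [CommMonoid M] (φ : ℕ → ℕ → M) (m : ℕ → ℕ) (n : ℕ) :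
    ((sortedList m n).mapIdx φ).prod =
      ∏ v ∈ range n, ∏ i ∈ range (m v), φ (i + ∑ u ∈ range v, m u) v := by
  induction n with
  | zero => simp [sortedList]
  | succ n ih =>
    rw [sortedList, List.mapIdx_append, List.prod_append, ih, prod_range_succ,
      prod_mapIdx_replicate, length_sortedList]

lemma prod_mapIdx_ofFn {M : Type*} [CommMonoid M] (φ : ℕ → ℕ → M) {k : ℕ} (g : Fin k → ℕ) :
    ((List.ofFn g).mapIdx φ).prod = ∏ j : Fin k, φ j (g j) := by
  rw [← List.prod_ofFn]
  congr 1
  refine List.ext_getElem (by simp) fun i _ _ => by simp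

lemma prod_div_prod_factorial_eq_staircaseCoeff (m : ℕ → ℕ) (n : ℕ) :
    (∏ v ∈ range n, ∏ i ∈ range (m v), ((v : ℚ) - ((i + ∑ u ∈ range v, m u : ℕ) : ℚ) + 1)) /
      ∏ v ∈ range n, ((m v).factorial : ℚ) = staircaseCoeff n m := by
  induction n with
  | zero => simp [staircaseCoeff]
  | succ n ih =>
    rw [prod_range_succ, prod_range_succ, mul_div_mul_comm, ih, staircaseCoeff_succ]
    by_cases h : n < ∑ u ∈ range n, m u
    · simp [staircaseCoeff_eq_zero h]
    · push Not at h
      rw [Nat.cast_mul, Nat.cast_choose_eq_descPochhammer_div,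
        descPochhammer_eval_eq_prod_range, Nat.cast_sub (by omega)]
      congr 2
      refine prod_congr rfl fun i _ => ?_
      push_cast
      ring

lemma count_ofFn {α : Type*} [DecidableEq α] {k : ℕ} (g : Fin k → α) (a : α) :
    (List.ofFn g).count a = #{j | g j = a} := by
  induction k with
  | zero => simp
  | succ k ih =>
    rw [List.ofFn_succ, List.count_cons, ih, Fin.card_filter_univ_succ]
    by_cases h : g 0 = a <;> simp [h]

lemma ofFn_eq_sortedList {n k : ℕ} {f : Fin k → Fin n} (hf : Monotone f) :
    List.ofFn (fun j => (f j : ℕ)) =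
      sortedList (fun v => #{j | (f j : ℕ) = v}) n := by
  refine List.Perm.eq_of_pairwise' (r := (· ≤ ·)) ?_ (pairwise_sortedList _ _) ?_
  · exact List.pairwise_ofFn.2 fun i j hij => hf hij.le
  · refine List.perm_iff_count.2 fun a => ?_
    rw [count_ofFn, count_sortedList]
    split_ifs with h
    · rfl
    · simp only [card_eq_zero, filter_eq_empty_iff]
      rintro j - rfl
      exact h (f j).2

lemma sum_monotone_eq_sum_piAntidiag {M : Type*} [AddCommMonoid M] (n k : ℕ)
    (F : (ℕ → ℕ) → M) :
    ∑ f : Fin k → Fin n with ∀ a b : Fin k, a ≤ b → f a ≤ f b, F (fun v => #{j | (f j : ℕ) = v}) =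
      ∑ m ∈ piAntidiag (range n) k, F m := by
  refine sum_nbij (fun f v => #{j | (f j : ℕ) = v}) ?_ ?_ ?_ fun _ _ => rfl
  · intro f hf
    have hf : Monotone f := fun a b => (mem_filter.1 hf).2 a b
    refine mem_piAntidiag.2 ⟨?_, fun v hv => ?_⟩
    · rw [← length_sortedList, ← ofFn_eq_sortedList hf, List.length_ofFn]
    · obtain ⟨j, hj⟩ := card_ne_zero.1 hv
      rw [← (mem_filter.1 hj).2]
      exact mem_range.2 (f j).2
  · intro f hf g hg h
    have hf : Monotone f := fun a b => (mem_filter.1 hf).2 a b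
    have hg : Monotone g := fun a b => (mem_filter.1 hg).2 a b
    have h' : List.ofFn (fun j => (f j : ℕ)) = List.ofFn (fun j => (g j : ℕ)) := by
      rw [ofFn_eq_sortedList hf, ofFn_eq_sortedList hg]
      exact congrArg (sortedList · n) h
    exact funext fun j => Fin.ext (congrFun (List.ofFn_injective h') j)
  · intro m hm
    obtain ⟨hs, hsupp⟩ := mem_piAntidiag.1 hm
    have hlen : (sortedList m n).length = k := (length_sortedList m n).trans hs
    subst hlen
    refine ⟨fun j => ⟨(sortedList m n)[j], lt_of_mem_sortedList (List.getElem_mem _)⟩, ?_, ?_⟩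
    · simp only [coe_filter, mem_univ, true_and, Set.mem_ofPred_eq, Fin.mk_le_mk]
      exact fun a b hab => (pairwise_sortedList m n).sortedLE.getElem_le_getElem_of_le hab
    · funext v
      refine (count_ofFn _ v).symm.trans ?_
      simp only [Fin.getElem_fin, List.ofFn_getElem, count_sortedList]
      split_ifs with h
      · rfl
      · by_contra h'
        exact h (mem_range.1 (hsupp v (Ne.symm h')))

/-- The staircase identity in `ℚ[x_1, …, x_n]` (indices written `0, …, n-1` via `Fin n`, so the
variable `x_r` of the informal statement is `X (r-1)` and a weakly increasing sequence
`1 ≤ r_1 ≤ … ≤ r_k ≤ n` corresponds to a monotone function `f : Fin k → Fin n` via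
`r_j = f (j-1) + 1`; the factor `r_j - j + 1` becomes `f j - j + 1` in `0`-based indexing and
`m(r)` becomes the number of `j` with `f j = r - 1`). -/
theorem staircase_expansion_poly (n : ℕ) :
    (∏ r : Fin n,
        (1 - ∑ i ∈ Finset.univ.filter (fun i : Fin n => r ≤ i), (X i : MvPolynomial (Fin n) ℚ))) =
      ∑ k ∈ Finset.range (n + 1),
        ∑ f ∈ Finset.univ.filter (fun f : Fin k → Fin n => ∀ a b : Fin k, a ≤ b → f a ≤ f b),
          (((-1 : ℚ) ^ k * ∏ j : Fin k, (((f j : ℕ) : ℚ) - ((j : ℕ) : ℚ) + 1)) /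
              ∏ v : Fin n, ((Finset.univ.filter fun j : Fin k => f j = v).card.factorial : ℚ)) •
            ∏ j : Fin k, (X (f j) : MvPolynomial (Fin n) ℚ) := by
  set x : ℕ → MvPolynomial (Fin n) ℚ := fun v => if h : v < n then X ⟨v, h⟩ else 0 with hx
  have hxX (i : Fin n) : x i = X i := by simp [hx]
  have hsum (r : Fin n) : ∑ i : Fin n with r ≤ i, (X i : MvPolynomial (Fin n) ℚ) =
      ∑ i ∈ Ico (r : ℕ) n, x i := by
    simp only [← hxX]
    refine sum_nbij (fun i => (i : ℕ)) (fun i hi => ?_) Fin.val_injective.injOn (fun i hi => ?_)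
      fun _ _ => rfl
    · exact mem_Ico.2 ⟨(mem_filter.1 hi).2, i.2⟩
    · obtain ⟨h₁, h₂⟩ := mem_Ico.1 hi
      exact ⟨⟨i, h₂⟩, mem_coe.2 (mem_filter.2 ⟨mem_univ _, h₁⟩), rfl⟩
  simp only [hsum]
  rw [Fin.prod_univ_eq_prod_range (fun r => 1 - ∑ i ∈ Ico r n, x i), prod_staircase]
  refine sum_congr rfl fun k _ => ?_
  rw [one_pow, mul_one, staircaseSum, ← sum_monotone_eq_sum_piAntidiag, mul_sum]
  refine sum_congr rfl fun f hf => ?_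
  have hf : Monotone f := fun a b => (mem_filter.1 hf).2 a b
  have hfac : ∏ v : Fin n, ((#{j | f j = v}).factorial : ℚ) =
      ∏ v ∈ range n, ((#{j | (f j : ℕ) = v}).factorial : ℚ) := by
    rw [← Fin.prod_univ_eq_prod_range (fun v => ((#{j | (f j : ℕ) = v}).factorial : ℚ))]
    simp only [Fin.ext_iff]
  rw [hfac, mul_div_assoc,
    ← prod_mapIdx_ofFn (fun j v => (v : ℚ) - (j : ℚ) + 1) fun j => (f j : ℕ),
    ofFn_eq_sortedList hf, prod_mapIdx_sortedList, prod_div_prod_factorial_eq_staircaseCoeff]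
  simp only [← hxX]
  rw [← prod_mapIdx_ofFn (fun _ v => x v) fun j => (f j : ℕ),
    ofFn_eq_sortedList hf, prod_mapIdx_sortedList]
  simp only [prod_const, card_range, Algebra.smul_def, map_mul, map_pow, map_neg, map_one,
    map_natCast]
  ring
end

section
/- Let M be a matroid on a finite ground set E and let i ∈ E. If F ∈ T and G ∈ U, then F and G are incomparable: neither F ⊆ G nor G ⊆ F. (In the Chow ring of M this gives x_F · x_G = 0 for all F ∈ T and G ∈ U.) -/
open Finset MvPolynomial

variable {α : Type*} [DecidableEq α]

/-- `T`: nonempty flats `F` with `i ∉ F` such that `F ∪ {i}` is not a flat. -/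
def Tset (E : Finset α) (rk : Finset α → ℕ) (i : α) : Finset (Finset α) :=
  (flats E rk).filter fun F => i ∉ F ∧ ¬ IsFlat E rk (insert i F)

/-- `S`: nonempty flats `F` with `i ∉ F` such that `F ∪ {i}` is a flat. -/
def Sset (E : Finset α) (rk : Finset α → ℕ) (i : α) : Finset (Finset α) :=
  (flats E rk).filter fun F => i ∉ F ∧ IsFlat E rk (insert i F)

/-- `U`: nonempty flats `F` with `i ∈ F` such that `F ∖ {i}` is a flat or `F ∖ {i} = ∅`. -/
def Uset (E : Finset α) (rk : Finset α → ℕ) (i : α) : Finset (Finset α) :=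
  (flats E rk).filter fun F => i ∈ F ∧ (IsFlat E rk (F.erase i) ∨ F.erase i = ∅)

/-- `V`: nonempty flats `F` with `i ∈ F`, `F ∖ {i} ≠ ∅` and `F ∖ {i}` not a flat. -/
def Vset (E : Finset α) (rk : Finset α → ℕ) (i : α) : Finset (Finset α) :=
  (flats E rk).filter fun F => i ∈ F ∧ F.erase i ≠ ∅ ∧ ¬ IsFlat E rk (F.erase i)

/-- Adding one element raises the rank by at most one. -/
theorem IsMatroidRank.rk_insert_le {E : Finset α} {rk : Finset α → ℕ} (hM : IsMatroidRank E rk)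
    {A : Finset α} {e : α} (hA : A ⊆ E) (he : e ∈ E) : rk (insert e A) ≤ rk A + 1 := by
  have heE : ({e} : Finset α) ⊆ E := Finset.singleton_subset_iff.2 he
  have hsub := hM.2.2 {e} A heE hA
  have hone := hM.1 {e} heE
  rw [← Finset.insert_eq] at hsub
  rw [Finset.card_singleton] at hone
  omega

/-- An element outside a flat strictly raises the rank of every subset of that flat. -/
theorem IsFlat.rk_lt_rk_insert {E : Finset α} {rk : Finset α → ℕ} (hM : IsMatroidRank E rk)
    {A B : Finset α} {j : α} (hB : IsFlat E rk B) (hAB : A ⊆ B) (hj : j ∈ E) (hjB : j ∉ B) :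
    rk A < rk (insert j A) := by
  have hlt := hB.2 j (Finset.mem_sdiff.2 ⟨hj, hjB⟩)
  have hsub := hM.2.2 B (insert j A) hB.1 (Finset.insert_subset hj (hAB.trans hB.1))
  rw [Finset.union_insert, Finset.union_eq_left.2 hAB, Finset.inter_insert_of_notMem hjB,
    Finset.inter_eq_right.2 hAB] at hsub
  omega

/-- If `F` and `G` are flats, `G ∖ {i}` is a flat containing `F`, and `i ∈ G`, then `F ∪ {i}` is
a flat. -/
theorem IsFlat.insert_of_subset_erase {E : Finset α} {rk : Finset α → ℕ}
    (hM : IsMatroidRank E rk) {F G : Finset α} {i : α} (hF : IsFlat E rk F) (hG : IsFlat E rk G)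
    (hiG : i ∈ G) (hGi : IsFlat E rk (G.erase i)) (hFG : F ⊆ G.erase i) :
    IsFlat E rk (insert i F) := by
  have hi : i ∈ E := hG.1 hiG
  refine ⟨Finset.insert_subset hi hF.1, fun j hj => ?_⟩
  obtain ⟨hjE, hjF⟩ := Finset.mem_sdiff.1 hj
  rw [Finset.mem_insert, not_or] at hjF
  by_cases hjG : j ∈ G
  · have hjF_lt := hF.2 j (Finset.mem_sdiff.2 ⟨hjE, hjF.2⟩)
    have hiF_le := hM.rk_insert_le hF.1 hi
    have hij_lt := hGi.rk_lt_rk_insert hM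
      (Finset.insert_subset (Finset.mem_erase.2 ⟨hjF.1, hjG⟩) hFG) hi (Finset.notMem_erase i G)
    rw [Finset.insert_comm] at hij_lt
    omega
  · exact hG.rk_lt_rk_insert hM
      (Finset.insert_subset hiG (hFG.trans (Finset.erase_subset i G))) hjE hjG

/-- Members of `T` and members of `U` are incomparable. -/
theorem T_U_incomparable (E : Finset α) (rk : Finset α → ℕ) (hM : IsMatroidRank E rk)
    (i : α) (hi : i ∈ E) (F G : Finset α) (hF : F ∈ Tset E rk i) (hG : G ∈ Uset E rk i) :
    ¬ F ⊆ G ∧ ¬ G ⊆ F := by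
  simp only [Tset, Uset, flats, Finset.mem_filter] at hF hG
  obtain ⟨⟨-, hF_nonempty, hF_flat⟩, hiF, hF_insert⟩ := hF
  obtain ⟨⟨-, -, hG_flat⟩, hiG, hG_erase⟩ := hG
  refine ⟨fun hFG => ?_, fun hGF => hiF (hGF hiG)⟩
  have hsub : F ⊆ G.erase i := Finset.subset_erase.2 ⟨hFG, hiF⟩
  have hGi := hG_erase.resolve_right (hF_nonempty.mono hsub).ne_empty
  exact hF_insert (hF_flat.insert_of_subset_erase hM hG_flat hiG hGi hsub)
end

section
/- Let M be a matroid on a finite ground set E and let i ∈ E. If F ∈ U and G ∈ V, then G ⊄ F (G is never contained in F); moreover, if in addition rk_M(G) < rk_M(F), then F and G are incomparable: neither F ⊆ G nor G ⊆ F. -/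
open Finset MvPolynomial

variable {α : Type*} [DecidableEq α]

/-- Adding `j` to a subset `C` of `A` raises the rank if adding `j` to `A` does. -/
lemma IsMatroidRank.lt_insert_of_subset {E : Finset α} {rk : Finset α → ℕ}
    (hM : IsMatroidRank E rk) {C A : Finset α} {j : α} (hCA : C ⊆ A) (hA : A ⊆ E) (hj : j ∈ E)
    (hjA : j ∉ A) (h : rk A < rk (insert j A)) : rk C < rk (insert j C) := by
  have hsub := hM.2.2 (insert j C) A (insert_subset hj (hCA.trans hA)) hA
  rw [insert_union, union_eq_right.2 hCA, insert_inter_of_notMem hjA,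
    inter_eq_left.2 hCA] at hsub
  omega

/-- The intersection of two flats is a flat. -/
lemma IsFlat.inter {E : Finset α} {rk : Finset α → ℕ} (hM : IsMatroidRank E rk)
    {A B : Finset α} (hA : IsFlat E rk A) (hB : IsFlat E rk B) : IsFlat E rk (A ∩ B) := by
  refine ⟨inter_subset_left.trans hA.1, fun j hj => ?_⟩
  obtain ⟨hjE, hj⟩ := mem_sdiff.1 hj
  by_cases hjA : j ∈ A
  · have hjB : j ∉ B := fun hjB => hj (mem_inter.2 ⟨hjA, hjB⟩)
    exact hM.lt_insert_of_subset inter_subset_right hB.1 hjE hjB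
      (hB.2 j (mem_sdiff.2 ⟨hjE, hjB⟩))
  · exact hM.lt_insert_of_subset inter_subset_left hA.1 hjE hjA
      (hA.2 j (mem_sdiff.2 ⟨hjE, hjA⟩))

/-- For `F ∈ U` and `G ∈ V`, `G` is never contained in `F`; moreover if `rk G < rk F`
then `F` and `G` are incomparable. -/
theorem U_V_incomparable (E : Finset α) (rk : Finset α → ℕ) (hM : IsMatroidRank E rk)
    (i : α) (hi : i ∈ E) (F G : Finset α) (hF : F ∈ Uset E rk i) (hG : G ∈ Vset E rk i) :
    ¬ G ⊆ F ∧ (rk G < rk F → ¬ F ⊆ G ∧ ¬ G ⊆ F) := by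
  have hGF : ¬ G ⊆ F := by
    intro hGF
    simp only [Uset, Vset, flats, mem_filter] at hF hG
    obtain ⟨-, -, hF | hF⟩ := hF
    · refine hG.2.2.2 ?_
      have heq : G ∩ F.erase i = G.erase i := by
        rw [inter_erase, inter_eq_left.2 hGF]
      exact heq ▸ hG.1.2.2.inter hM hF
    · exact hG.2.2.1 (subset_empty.1 (hF ▸ erase_subset_erase i hGF))
  refine ⟨hGF, fun hlt => ⟨fun hFG => ?_, hGF⟩⟩
  have hGE : G ⊆ E := mem_powerset.1 (mem_filter.1 (mem_filter.1 hG).1).1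
  exact absurd (hM.2.1 F G hFG hGE) (not_le.2 hlt)
end

section
/- Let M be a loopless matroid on a finite ground set E and let i ∈ E be an element that is not a coloop. The ring homomorphism Δ : ℤ[y_F : F ∈ L(M∖i)] → ℤ[x_F : F ∈ L(M)] determined by Δ(y_F) = ∑_{F' ∈ L(M), F'∖{i} = F} x_{F'} maps the ideal I_{M∖i} + J_{M∖i} into the ideal I_M + J_M; consequently Δ induces a ring homomorphism δ̄* : A^*(M∖i) → A^*(M) between the Chow rings. -/
open Finset MvPolynomial

variable {α : Type*} [DecidableEq α]

/-- The ring homomorphism `Δ : ℤ[y_F : F ∈ L(M∖i)] → ℤ[x_F : F ∈ L(M)]`,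
`y_F ↦ ∑_{F' ∈ L(M), F'∖{i} = F} x_{F'}`. -/
noncomputable def delMap (E : Finset α) (rk : Finset α → ℕ) (i : α) :
    MvPolynomial (FlatIdx (E.erase i) rk) ℤ →ₐ[ℤ] MvPolynomial (FlatIdx E rk) ℤ :=
  aeval fun F => ∑ F' ∈ Finset.univ.filter (fun F' : FlatIdx E rk => F'.1.erase i = F.1), X F'

/-- Deleting `i` from a flat of `M` gives a flat of `M ∖ i`. -/
theorem IsFlat.erase {E : Finset α} {rk : Finset α → ℕ} (hM : IsMatroidRank E rk) {F : Finset α}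
    (hF : IsFlat E rk F) (i : α) : IsFlat (E.erase i) rk (F.erase i) := by
  refine ⟨Finset.erase_subset_erase i hF.1, fun k hk => ?_⟩
  obtain ⟨⟨hki, hkE⟩, hkF⟩ : (k ≠ i ∧ k ∈ E) ∧ k ∉ F := by
    simp only [Finset.mem_sdiff, Finset.mem_erase] at hk
    tauto
  have hlt := hF.2 k (Finset.mem_sdiff.2 ⟨hkE, hkF⟩)
  have hsub : insert k (F.erase i) ⊆ E :=
    Finset.insert_subset hkE ((Finset.erase_subset i F).trans hF.1)
  have hrk := hM.2.2 (insert k (F.erase i)) F hsub hF.1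
  have hunion : insert k (F.erase i) ∪ F = insert k F := by
    rw [Finset.insert_union, Finset.union_eq_right.2 (Finset.erase_subset i F)]
  have hinter : insert k (F.erase i) ∩ F = F.erase i := by
    rw [Finset.insert_inter_of_notMem hkF, Finset.inter_eq_left.2 (Finset.erase_subset i F)]
  rw [hunion, hinter] at hrk
  omega

theorem erase_mem_flats {E : Finset α} {rk : Finset α → ℕ} (hM : IsMatroidRank E rk)
    {F : Finset α} (hF : F ∈ flats E rk) {i j : α} (hji : j ≠ i) (hj : j ∈ F) :
    F.erase i ∈ flats (E.erase i) rk := by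
  have hflat := (Finset.mem_filter.1 hF).2.2.erase hM i
  exact Finset.mem_filter.2 ⟨Finset.mem_powerset.2 hflat.1,
    ⟨j, Finset.mem_erase.2 ⟨hji, hj⟩⟩, hflat⟩

theorem delMap_X (E : Finset α) (rk : Finset α → ℕ) (i : α) (F : FlatIdx (E.erase i) rk) :
    delMap E rk i (X F) =
      ∑ F' ∈ Finset.univ.filter (fun F' : FlatIdx E rk => F'.1.erase i = F.1), X F' :=
  aeval_X _ F

/-- `Δ` sends the product of the variables of two incomparable flats into `I_M + J_M`. -/
theorem delMap_X_mul_X_mem (E : Finset α) (rk : Finset α → ℕ) (i : α)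
    (F F' : FlatIdx (E.erase i) rk) (h : ¬ F.1 ⊆ F'.1) (h' : ¬ F'.1 ⊆ F.1) :
    delMap E rk i (X F * X F') ∈ chowIdeal E rk := by
  rw [map_mul, delMap_X, delMap_X, Finset.sum_mul_sum]
  refine Ideal.sum_mem _ fun G hG => Ideal.sum_mem _ fun G' hG' => Ideal.subset_span (Or.inl ?_)
  replace hG := (Finset.mem_filter.1 hG).2
  replace hG' := (Finset.mem_filter.1 hG').2
  rw [← hG, ← hG'] at h h'
  exact ⟨G, G', fun hs => h (Finset.erase_subset_erase i hs),
    fun hs => h' (Finset.erase_subset_erase i hs), rfl⟩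

/-- For `j ≠ i`, `Δ` sends the linear form of `j` in `M ∖ i` to the linear form of `j` in `M`. -/
theorem delMap_sum_X {E : Finset α} {rk : Finset α → ℕ} (hM : IsMatroidRank E rk) {i j : α}
    (hji : j ≠ i) :
    delMap E rk i
        (∑ F ∈ Finset.univ.filter (fun F : FlatIdx (E.erase i) rk => j ∈ F.1), X F) =
      ∑ F ∈ Finset.univ.filter (fun F : FlatIdx E rk => j ∈ F.1), X F := by
  simp only [map_sum, delMap_X]
  rw [Finset.sum_sigma']
  refine Finset.sum_bij' (fun p _ => p.2)
    (fun F hF => ⟨⟨F.1.erase i, erase_mem_flats hM F.2 hji (Finset.mem_filter.1 hF).2⟩, F⟩)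
    ?_ ?_ ?_ ?_ ?_
  · rintro ⟨F, F'⟩ hp
    simp only [Finset.mem_sigma, Finset.mem_filter, Finset.mem_univ, true_and] at hp ⊢
    rw [← hp.2] at hp
    exact Finset.mem_of_mem_erase hp.1
  · intro F hF
    simp only [Finset.mem_sigma, Finset.mem_filter, Finset.mem_univ, true_and, and_true] at hF ⊢
    exact Finset.mem_erase.2 ⟨hji, hF⟩
  · rintro ⟨⟨F, hF⟩, F'⟩ hp
    simp only [Finset.mem_sigma, Finset.mem_filter, Finset.mem_univ, true_and] at hp
    obtain ⟨-, rfl⟩ := hp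
    rfl
  · intros
    rfl
  · intros
    rfl

/-- The ring homomorphism `Δ` maps the ideal `I_{M∖i} + J_{M∖i}` into `I_M + J_M`, hence
induces a ring homomorphism `δ̄* : A^*(M∖i) → A^*(M)`. -/
theorem delMap_maps_ideal (E : Finset α) (rk : Finset α → ℕ) (hM : IsMatroidRank E rk)
    (hloopless : ∀ j ∈ E, rk {j} ≠ 0) (i : α) (hi : i ∈ E)
    (hcoloop : rk (E.erase i) + 1 ≠ rk E) :
    ∀ p ∈ chowIdeal (E.erase i) rk, delMap E rk i p ∈ chowIdeal E rk := by
  suffices h : chowIdeal (E.erase i) rk ≤ (chowIdeal E rk).comap (delMap E rk i) from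
    fun p hp => h hp
  refine Ideal.span_le.2 ?_
  rintro p (⟨F, F', h, h', rfl⟩ | ⟨j, hj, rfl⟩)
  · exact delMap_X_mul_X_mem E rk i F F' h h'
  · obtain ⟨hji, hjE⟩ := Finset.mem_erase.1 hj
    rw [SetLike.mem_coe, Ideal.mem_comap, delMap_sum_X hM hji]
    exact Ideal.subset_span (Or.inr ⟨j, hjE, rfl⟩)
end

section
/- Let M be a matroid on a finite ground set E, let i ∈ E, and let F be a nonempty flat of the deletion M∖i. Then the set {F' ∈ L(M) : F' ∖ {i} = F} equals: {F} if F ∈ T; {F, F ∪ {i}} if F ∈ S; and {F ∪ {i}} if F is not a flat of M. -/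
open Finset MvPolynomial

variable {α : Type*} [DecidableEq α]

theorem erase_eq_iff_of_notMem {i : α} {F : Finset α} (hiF : i ∉ F) (G : Finset α) :
    G.erase i = F ↔ G = F ∨ G = insert i F := by
  constructor
  · rintro rfl
    by_cases hiG : i ∈ G
    · exact Or.inr (insert_erase hiG).symm
    · exact Or.inl (erase_eq_of_notMem hiG).symm
  · rintro (rfl | rfl)
    · exact erase_eq_of_notMem hiF
    · exact erase_insert hiF

theorem mem_flats {E : Finset α} {rk : Finset α → ℕ} {F : Finset α} :
    F ∈ flats E rk ↔ F.Nonempty ∧ IsFlat E rk F := by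
  simp only [flats, mem_filter, mem_powerset, and_iff_right_iff_imp]
  exact fun h => h.2.1

/-- If a flat `F` of the deletion `M∖i` is not a flat of `M`, then `i` lies in its closure, so
`F ∪ {i}` is a flat of `M`. -/
theorem IsFlat.insert_of_not_isFlat {E : Finset α} {rk : Finset α → ℕ}
    (hM : IsMatroidRank E rk) {i : α} (hi : i ∈ E) {F : Finset α}
    (hF : IsFlat (E.erase i) rk F) (hnF : ¬ IsFlat E rk F) : IsFlat E rk (insert i F) := by
  have hFE : F ⊆ E := hF.1.trans (erase_subset i E)
  have hlt : ∀ j ∈ E, j ≠ i → j ∉ F → rk F < rk (insert j F) := fun j hj hji hjF =>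
    hF.2 j (mem_sdiff.2 ⟨mem_erase.2 ⟨hji, hj⟩, hjF⟩)
  have hrk : rk (insert i F) ≤ rk F := by
    by_contra! h
    refine hnF ⟨hFE, fun j hj => ?_⟩
    obtain ⟨hjE, hjF⟩ := mem_sdiff.1 hj
    obtain rfl | hji := eq_or_ne j i
    · exact h
    · exact hlt j hjE hji hjF
  have hiFE : insert i F ⊆ E := insert_subset hi hFE
  refine ⟨hiFE, fun j hj => ?_⟩
  obtain ⟨hjE, hj⟩ := mem_sdiff.1 hj
  rw [mem_insert, not_or] at hj
  exact hrk.trans_lt <| (hlt j hjE hj.1 hj.2).trans_le <|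
    hM.2.1 _ _ (insert_subset_insert j (subset_insert i F)) (insert_subset hjE hiFE)

/-- For a nonempty flat `F` of the deletion `M∖i`, the set `{F' ∈ L(M) : F' ∖ {i} = F}` is
`{F}` if `F ∈ T`, is `{F, F ∪ {i}}` if `F ∈ S`, and is `{F ∪ {i}}` if `F` is not a flat
of `M`. -/
theorem fibers_of_deletion (E : Finset α) (rk : Finset α → ℕ) (hM : IsMatroidRank E rk)
    (i : α) (hi : i ∈ E) (F : Finset α) (hF : F ∈ flats (E.erase i) rk) :
    (F ∈ Tset E rk i → (flats E rk).filter (fun F' => F'.erase i = F) = {F}) ∧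
    (F ∈ Sset E rk i → (flats E rk).filter (fun F' => F'.erase i = F) = {F, insert i F}) ∧
    (¬ IsFlat E rk F → (flats E rk).filter (fun F' => F'.erase i = F) = {insert i F}) := by
  obtain ⟨hne, hflat⟩ := mem_flats.1 hF
  have hiF : i ∉ F := fun h => notMem_erase i E (hflat.1 h)
  simp only [Tset, Sset, mem_filter, Finset.ext_iff (α := Finset α), mem_singleton, mem_insert,
    mem_flats, erase_eq_iff_of_notMem hiF]
  have hne' : (insert i F).Nonempty := insert_nonempty i F
  refine ⟨fun ⟨⟨_, hFM⟩, _, hiM⟩ G => ?_, fun ⟨⟨_, hFM⟩, _, hiM⟩ G => ?_, fun hFM G => ?_⟩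
  · constructor
    · rintro ⟨⟨_, hG⟩, rfl | rfl⟩
      · rfl
      · exact absurd hG hiM
    · rintro rfl
      exact ⟨⟨hne, hFM⟩, Or.inl rfl⟩
  · refine and_iff_right_of_imp ?_
    rintro (rfl | rfl)
    · exact ⟨hne, hFM⟩
    · exact ⟨hne', hiM⟩
  · constructor
    · rintro ⟨⟨_, hG⟩, rfl | rfl⟩
      · exact absurd hG hFM
      · rfl
    · rintro rfl
      exact ⟨⟨hne', hflat.insert_of_not_isFlat hM hi hFM⟩, Or.inr rfl⟩
end

section
/- For every weakly increasing sequence 1 ≤ r_1 ≤ r_2 ≤ … ≤ r_k of positive integers, the product of factorials ∏_r m(r)! divides the product ∏_{j=1}^{k} (r_j − j + 1) in ℤ, where m(r) = #{j : r_j = r} is the multiplicity of r in the sequence. (Hence the Fife–Rincón coefficient C = (−1)^k (∏_{j=1}^k (r_j − j + 1)) / (∏_r m(r)!) is an integer.) -/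
open Finset

/-- The product of `m` consecutive integers, in decreasing order, is divisible by `m!`. -/
lemma Int.factorial_dvd_prod_range_sub (c : ℤ) (m : ℕ) :
    (m.factorial : ℤ) ∣ ∏ i ∈ Finset.range m, (c - (i : ℤ)) := by
  rw [← descPochhammer_eval_eq_prod_range, Polynomial.eval_eq_smeval,
    Ring.descPochhammer_eq_factorial_smul_choose, nsmul_eq_mul]
  exact dvd_mul_right _ _

/-- For an order-connected finite set `S` of naturals, `∏ j ∈ S, (c - j)` is divisible by
the factorial of the cardinality of `S`. -/
lemma Int.factorial_card_dvd_prod_sub (c : ℤ) (S : Finset ℕ)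
    (hS : (S : Set ℕ).OrdConnected) :
    (S.card.factorial : ℤ) ∣ ∏ j ∈ S, (c - (j : ℤ)) := by
  rcases S.eq_empty_or_nonempty with rfl | hne
  · simp
  have hIco : S = Finset.Ico (S.min' hne) (S.max' hne + 1) := by
    ext x
    rw [Finset.mem_Ico, Nat.lt_succ_iff]
    exact ⟨fun hx => ⟨S.min'_le x hx, S.le_max' x hx⟩,
      fun hx => hS.out (S.min'_mem hne) (S.max'_mem hne) hx⟩
  generalize S.min' hne = a at hIco
  generalize S.max' hne + 1 = b at hIco
  subst hIco
  rw [Nat.card_Ico, Finset.prod_Ico_eq_prod_range]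
  simpa only [Nat.cast_add, sub_sub] using Int.factorial_dvd_prod_range_sub (c - a) (b - a)

/-- For a weakly increasing sequence `1 ≤ r_1 ≤ … ≤ r_k` of positive integers (written
`0`-based as a monotone `r : Fin k → ℕ`), the product of factorials `∏_r m(r)!` of the
multiplicities divides `∏_{j=1}^k (r_j - j + 1)` in `ℤ` (which is `∏_j (r j - j)` in
`0`-based indexing); hence the Fife–Rincón coefficient is an integer. -/
theorem multiplicity_factorials_dvd (k : ℕ) (r : Fin k → ℕ) (hmono : Monotone r)
    (hpos : ∀ j, 1 ≤ r j) :
    (∏ v ∈ Finset.univ.image r,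
        ((Finset.univ.filter fun j : Fin k => r j = v).card.factorial : ℤ)) ∣
      ∏ j : Fin k, ((r j : ℤ) - ((j : ℕ) : ℤ)) := by
  rw [← Finset.prod_fiberwise_of_maps_to (g := r) (t := Finset.univ.image r)
    (fun j hj => Finset.mem_image_of_mem r hj)]
  refine Finset.prod_dvd_prod_of_dvd _ _ fun v _ => ?_
  have hconn : (((Finset.univ.filter fun j : Fin k => r j = v).map Fin.valEmbedding :
      Finset ℕ) : Set ℕ).OrdConnected := by
    refine ⟨fun x hx y hy z hz => ?_⟩
    simp only [Finset.coe_map, Finset.coe_filter, Finset.mem_univ, true_and, Set.mem_image,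
      Set.mem_ofPred_eq, Fin.valEmbedding_apply] at hx hy ⊢
    obtain ⟨i, hi, rfl⟩ := hx
    obtain ⟨j, hj, rfl⟩ := hy
    refine ⟨⟨z, hz.2.trans_lt j.isLt⟩, le_antisymm ?_ ?_, rfl⟩
    · exact hj ▸ hmono (Fin.le_def.mpr hz.2)
    · exact hi ▸ hmono (Fin.le_def.mpr hz.1)
  have hdvd := Int.factorial_card_dvd_prod_sub v _ hconn
  rw [Finset.card_map, Finset.prod_map] at hdvd
  refine hdvd.trans (dvd_of_eq (Finset.prod_congr rfl fun j hj => ?_))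
  rw [(Finset.mem_filter.mp hj).2, Fin.valEmbedding_apply]
end
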